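/- Let G be a finite group such that exactly two elements of cs(G) are composite numbers. Then 3 ≤ |cs(G)| ≤ 6. -/

import Mathlib

/-- The set of conjugacy class sizes of a group `G`. -/
def csSet (G : Type*) [Group G] : Set ℕ :=
  {n | ∃ g : G, n = (Subgroup.centralizer {g} : Subgroup G).index}

/-- A natural number is composite if it is greater than 1 and not prime. -/
def IsCompositeNat (n : ℕ) : Prop := 1 < n ∧ ¬ n.Prime

open scoped Pointwise in
theorem order_dvd_of_smul_set {G : Type*} [Group G] [Finite G] (B : Set G) (h : G)
    (hB : ∀ b ∈ B, h * b ∈ B) : orderOf h ∣ B.ncard := by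
  classical
  have hpow : ∀ n : ℕ, ∀ b ∈ B, h ^ n * b ∈ B := by
    intro n
    induction n with
    | zero => intro b hb; simpa using hb
    | succ n ih => intro b hb; rw [pow_succ, mul_assoc]; exact ih _ (hB b hb)
  have hz : ∀ k : Subgroup.zpowers h, ∀ b ∈ B, (k : G) * b ∈ B := by
    rintro ⟨k, hk⟩ b hb
    obtain ⟨n, rfl⟩ := mem_powers_iff_mem_zpowers.2 hk
    exact hpow n b hb
  letI : MulAction (Subgroup.zpowers h) B :=
    { smul := fun k b => ⟨(k : G) * b, hz k b b.2⟩
      one_smul := fun b => Subtype.ext (one_mul (b : G))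
      mul_smul := fun k l b => Subtype.ext (mul_assoc (k : G) l b) }
  have hst : ∀ b : B, MulAction.stabilizer (Subgroup.zpowers h) b = ⊥ := by
    intro b
    rw [eq_bot_iff]
    intro k hk
    have h1 : ((k : G) * b) = b := congrArg Subtype.val (MulAction.mem_stabilizer_iff.1 hk)
    have : (k : G) = 1 := by simpa using h1
    exact Subgroup.mem_bot.2 (Subtype.ext this)
  have e := MulAction.selfEquivOrbitsQuotientProd hst
  have := Nat.card_congr e
  rw [Nat.card_prod, Nat.card_zpowers] at this
  rw [← Nat.card_coe_set_eq, this]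
  exact Dvd.intro_left _ rfl

theorem index_cent {G : Type*} [Group G] [Finite G] (x : G) :
    (Subgroup.centralizer {x} : Subgroup G).index = (MulAction.orbit (ConjAct G) x).ncard := by
  rw [← MulAction.index_stabilizer, ConjAct.stabilizer_eq_centralizer]
  rfl

theorem index_cent2 {G : Type*} [Group G] [Finite G] (x y : G) :
    (Subgroup.centralizer {x} ⊓ Subgroup.centralizer {y} : Subgroup G).index
      = (MulAction.orbit (ConjAct G) (x, y)).ncard := by
  rw [← MulAction.index_stabilizer]
  have : MulAction.stabilizer (ConjAct G) (x, y) =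
      MulAction.stabilizer (ConjAct G) x ⊓ MulAction.stabilizer (ConjAct G) y := by
    ext g
    simp [MulAction.mem_stabilizer_iff, Prod.ext_iff]
  rw [this, ConjAct.stabilizer_eq_centralizer, ConjAct.stabilizer_eq_centralizer]
  rfl

theorem cent_mul {G : Type*} [Group G] (x y : G) :
    (Subgroup.centralizer {x} ⊓ Subgroup.centralizer {y} : Subgroup G) ≤
      Subgroup.centralizer {x * y} := by
  intro g hg
  rw [Subgroup.mem_inf, Subgroup.mem_centralizer_singleton_iff,
    Subgroup.mem_centralizer_singleton_iff] at hg
  rw [Subgroup.mem_centralizer_singleton_iff]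
  have h1 : Commute x g := hg.1.symm
  have h2 : Commute y g := hg.2.symm
  exact (h1.mul_left h2).symm.eq

theorem index_inf_le' {G : Type*} [Group G] [Finite G] (H K : Subgroup G) :
    ∃ t, t ≤ K.index ∧ 0 < t ∧ (H ⊓ K).index = t * H.index := by
  refine ⟨(H ⊓ K).relIndex H, ?_, ?_, (Subgroup.relIndex_mul_index inf_le_left).symm⟩
  · rw [Subgroup.inf_relIndex_left, ← Subgroup.relIndex_top_right]
    exact Subgroup.relIndex_le_of_le_right le_top
      (by rw [Subgroup.relIndex_top_right]; exact Subgroup.index_ne_zero_of_finite)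
  · exact Nat.pos_of_ne_zero Subgroup.index_ne_zero_of_finite

/-- The key dichotomy. -/
theorem key {G : Type*} [Group G] [Finite G] {p q : ℕ} (hp : p.Prime) (hq : q.Prime) (hpq : p < q)
    (x y : G) (hx : (Subgroup.centralizer {x} : Subgroup G).index = p)
    (hy : (Subgroup.centralizer {y} : Subgroup G).index = q) :
    p * q ∈ csSet G ∨ ∀ g : ConjAct G, orderOf (x⁻¹ * (g • x)) ∣ q := by
  have hcop : Nat.Coprime p q := (Nat.coprime_primes hp hq).2 hpq.ne
  have hinf : (Subgroup.centralizer {x} ⊓ Subgroup.centralizer {y} : Subgroup G).index = p * q := by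
    apply le_antisymm
    · rw [← hx, ← hy]; exact Subgroup.index_inf_le
    · apply Nat.le_of_dvd (Nat.pos_of_ne_zero Subgroup.index_ne_zero_of_finite)
      apply hcop.mul_dvd_of_dvd_of_dvd
      · rw [← hx]; exact Subgroup.index_dvd_of_le inf_le_left
      · rw [← hy]; exact Subgroup.index_dvd_of_le inf_le_right
  have hd := Subgroup.index_dvd_of_le (cent_mul x y)
  rw [hinf] at hd
  have hqd : q ∣ (Subgroup.centralizer {x * y} : Subgroup G).index := by
    by_contra hqd
    have hp' : (Subgroup.centralizer {x * y} : Subgroup G).index ∣ p :=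
      Nat.Coprime.dvd_of_dvd_mul_right (((Nat.Prime.coprime_iff_not_dvd hq).2 hqd).symm) hd
    obtain ⟨t, ht, ht0, hte⟩ := index_inf_le' (Subgroup.centralizer {x⁻¹} : Subgroup G)
      (Subgroup.centralizer {x * y})
    have h1 := Subgroup.index_dvd_of_le (cent_mul x⁻¹ (x * y))
    rw [inv_mul_cancel_left, hte, hy] at h1
    have hxi : (Subgroup.centralizer {x⁻¹} : Subgroup G) = Subgroup.centralizer {x} := by
      ext g
      rw [Subgroup.mem_centralizer_singleton_iff, Subgroup.mem_centralizer_singleton_iff]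
      exact (Commute.inv_right_iff (a := g) (b := x))
    rw [hxi, hx] at h1
    have h2 := Nat.le_of_dvd hp.pos hp'
    rcases (Nat.Prime.dvd_mul hq).1 h1 with h3 | h3
    · have := Nat.le_of_dvd ht0 h3; omega
    · have := Nat.le_of_dvd hp.pos h3; omega
  obtain ⟨s, hs⟩ := hqd
  have hsp : s ∣ p := by
    rw [hs, mul_comm p q] at hd
    exact Nat.dvd_of_mul_dvd_mul_left hq.pos hd
  rcases (Nat.dvd_prime hp).1 hsp with rfl | rfl
  · right
    intro g
    rw [mul_one] at hs
    rw [index_cent] at hs hx hy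
    rw [index_cent2] at hinf
    have hsub : MulAction.orbit (ConjAct G) (x, y) ⊆
        MulAction.orbit (ConjAct G) x ×ˢ MulAction.orbit (ConjAct G) y := by
      rintro _ ⟨g, rfl⟩
      exact ⟨⟨g, rfl⟩, ⟨g, rfl⟩⟩
    have heq := Set.eq_of_subset_of_ncard_le hsub
      (by rw [Set.ncard_prod, hx, hy, hinf]) (Set.toFinite _)
    have hmul : ∀ a ∈ MulAction.orbit (ConjAct G) x,
        (fun b => a * b) '' MulAction.orbit (ConjAct G) y = MulAction.orbit (ConjAct G) (x * y) := by
      intro a ha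
      apply Set.eq_of_subset_of_ncard_le _ _ (Set.toFinite _)
      · rintro _ ⟨b, hb, rfl⟩
        have : (a, b) ∈ MulAction.orbit (ConjAct G) (x, y) := by rw [heq]; exact ⟨ha, hb⟩
        obtain ⟨k, hk⟩ := this
        refine ⟨k, ?_⟩
        have e1 : k • x = a := congrArg Prod.fst hk
        have e2 : k • y = b := congrArg Prod.snd hk
        simp only [smul_mul', e1, e2]
      · rw [Set.ncard_image_of_injective _ (mul_right_injective a), hs, hy]
    rw [← hy]
    apply order_dvd_of_smul_set
    intro b hb
    have h1 : (g • x) * b ∈ MulAction.orbit (ConjAct G) (x * y) := by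
      rw [← hmul (g • x) ⟨g, rfl⟩]; exact ⟨b, hb, rfl⟩
    rw [← hmul x (MulAction.mem_orbit_self x)] at h1
    obtain ⟨c, hc, hce⟩ := h1
    have : x⁻¹ * g • x * b = c := by
      rw [mul_assoc, ← hce]; simp
    rw [this]; exact hc
  · left
    exact ⟨x * y, by rw [hs, mul_comm]⟩

theorem key2 {G : Type*} [Group G] [Finite G] {p q r : ℕ} (hp : p.Prime) (hq : q.Prime)
    (hr : r.Prime) (hpq : p < q) (hqr : q < r) (hpc : p ∈ csSet G) (hqc : q ∈ csSet G)
    (hrc : r ∈ csSet G) : p * q ∈ csSet G ∨ p * r ∈ csSet G := by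
  obtain ⟨x, hx⟩ := hpc
  obtain ⟨y, hy⟩ := hqc
  obtain ⟨z, hz⟩ := hrc
  rcases key hp hq hpq x y hx.symm hy.symm with h | h1
  · exact Or.inl h
  rcases key hp hr (hpq.trans hqr) x z hx.symm hz.symm with h | h2
  · exact Or.inr h
  exfalso
  have hcop : Nat.Coprime q r := (Nat.coprime_primes hq hr).2 hqr.ne
  have hfix : ∀ g : ConjAct G, g • x = x := by
    intro g
    have := Nat.eq_one_of_dvd_coprimes hcop (h1 g) (h2 g)
    rw [orderOf_eq_one_iff] at this
    exact (inv_mul_eq_one.1 this).symm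
  rw [index_cent] at hx
  have : MulAction.orbit (ConjAct G) x = {x} := by
    ext a
    constructor
    · rintro ⟨g, rfl⟩; exact hfix g
    · rintro rfl; exact MulAction.mem_orbit_self _
  rw [this, Set.ncard_singleton] at hx
  exact hp.one_lt.ne' hx

theorem key4 {G : Type*} [Group G] [Finite G] {a b c d : ℕ} (ha : a.Prime) (hb : b.Prime)
    (hc : c.Prime) (hd : d.Prime) (hab : a < b) (hbc : b < c) (hcd : c < d)
    (hac : a ∈ csSet G) (hbcs : b ∈ csSet G) (hcc : c ∈ csSet G) (hdc : d ∈ csSet G)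
    (hfin : {n ∈ csSet G | IsCompositeNat n}.Finite)
    (hcomp : {n ∈ csSet G | IsCompositeNat n}.ncard = 2) : False := by
  have hprod : ∀ {u v : ℕ}, u.Prime → v.Prime → u * v ∈ csSet G →
      u * v ∈ {n ∈ csSet G | IsCompositeNat n} := by
    intro u v hu hv h
    refine ⟨h, ?_, Nat.not_prime_mul hu.ne_one hv.ne_one⟩
    exact Nat.one_lt_mul_iff.2 ⟨hu.pos, hv.pos, Or.inl hu.one_lt⟩
  have hthree : ∀ u v w : ℕ, u ∈ {n ∈ csSet G | IsCompositeNat n} →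
      v ∈ {n ∈ csSet G | IsCompositeNat n} → w ∈ {n ∈ csSet G | IsCompositeNat n} →
      u < v → v ≠ w → u < w → False := by
    intro u v w hu hv hw h1 h2 h3
    have hs : ({u, v, w} : Set ℕ) ⊆ {n ∈ csSet G | IsCompositeNat n} := by
      rintro t (rfl | rfl | rfl) <;> assumption
    have := Set.ncard_le_ncard hs hfin
    rw [hcomp, Set.ncard_eq_three.2 ⟨u, v, w, h1.ne, h3.ne, h2, rfl⟩] at this
    omega
  have hne : ∀ {v : ℕ}, v.Prime → v = c ∨ v = d → ∀ w, a * w ≠ b * v := by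
    intro v hv hvv w h
    have : a ∣ b * v := ⟨w, h.symm⟩
    rcases (Nat.Prime.dvd_mul ha).1 this with h | h
    · have := (Nat.prime_dvd_prime_iff_eq ha hb).1 h; omega
    · have := (Nat.prime_dvd_prime_iff_eq ha hv).1 h; omega
  have h1 := key2 ha hb hc hab hbc hac hbcs hcc
  have h2 := key2 ha hc hd (hab.trans hbc) hcd hac hcc hdc
  have h3 := key2 ha hb hd hab (hbc.trans hcd) hac hbcs hdc
  have h4 := key2 hb hc hd hbc hcd hbcs hcc hdc
  have mbc : a * b < a * c := Nat.mul_lt_mul_of_pos_left hbc ha.pos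
  have mcd : a * c < a * d := Nat.mul_lt_mul_of_pos_left hcd ha.pos
  obtain ⟨v, hv, hvv, hvc⟩ : ∃ v, v.Prime ∧ (v = c ∨ v = d) ∧ b * v ∈ csSet G := by
    rcases h4 with h | h
    · exact ⟨c, hc, Or.inl rfl, h⟩
    · exact ⟨d, hd, Or.inr rfl, h⟩
  have hlt : ∀ w, w ≤ d → w ≤ v ∨ (v = c ∧ w = d) ∨ v < w := by intros; omega
  have hS := hprod hb hv hvc
  have fin : ∀ u w, u.Prime → w.Prime → a * u ∈ csSet G → a * w ∈ csSet G → u < w → False := by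
    intro u w hu hw h h' huw
    have hs : ({a * u, a * w, b * v} : Set ℕ) ⊆ {n ∈ csSet G | IsCompositeNat n} := by
      rintro t (rfl | rfl | rfl)
      · exact hprod ha hu h
      · exact hprod ha hw h'
      · exact hS
    have hh := Set.ncard_le_ncard hs hfin
    rw [hcomp, Set.ncard_eq_three.2 ⟨_, _, _, (Nat.mul_lt_mul_of_pos_left huw ha.pos).ne,
      hne hv hvv u, hne hv hvv w, rfl⟩] at hh
    omega
  rcases h1 with h1 | h1
  · rcases h2 with h2 | h2
    · exact fin b c hb hc h1 h2 hbc
    · exact fin b d hb hd h1 h2 (hbc.trans hcd)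
  · rcases h3 with h3 | h3
    · exact fin b c hb hc h3 h1 hbc
    · exact fin c d hc hd h1 h3 hcd

theorem csSet_finite (G : Type*) [Group G] [Finite G] : (csSet G).Finite := by
  have : csSet G = Set.range (fun g : G => (Subgroup.centralizer {g} : Subgroup G).index) := by
    ext n; simp [csSet, eq_comm]
  rw [this]; exact Set.finite_range _

theorem four_sorted (S : Set ℕ) (h : 4 ≤ S.ncard) :
    ∃ a b c d, a ∈ S ∧ b ∈ S ∧ c ∈ S ∧ d ∈ S ∧ a < b ∧ b < c ∧ c < d := by
  have hf : S.Finite := Set.finite_of_ncard_pos (by omega)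
  obtain ⟨T, hT⟩ := hf.exists_finset_coe
  subst hT
  rw [Set.ncard_coe_finset] at h
  let e := T.orderEmbOfCardLe h
  have he : ∀ i, e i ∈ T := fun i => T.orderEmbOfCardLe_mem h i
  exact ⟨e 0, e 1, e 2, e 3, he 0, he 1, he 2, he 3, e.strictMono (by decide),
    e.strictMono (by decide), e.strictMono (by decide)⟩

/-- If a finite group has exactly two composite conjugacy class sizes, then
`3 ≤ |cs(G)| ≤ 6`. -/
theorem stmt_3 (G : Type*) [Group G] [Finite G]
    (hcomp : {n ∈ csSet G | IsCompositeNat n}.ncard = 2) :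
    3 ≤ (csSet G).ncard ∧ (csSet G).ncard ≤ 6 := by
  have hfin := csSet_finite G
  have hfC : {n ∈ csSet G | IsCompositeNat n}.Finite := hfin.subset (fun _ h => h.1)
  have h1 : 1 ∈ csSet G := ⟨1, by
    have : (Subgroup.centralizer {1} : Subgroup G) = ⊤ := by
      ext g; simp [Subgroup.mem_centralizer_singleton_iff]
    rw [this, Subgroup.index_top]⟩
  have h1C : 1 ∉ {n ∈ csSet G | IsCompositeNat n} := fun h => absurd h.2.1 (lt_irrefl 1)
  have hins := Set.ncard_insert_of_notMem h1C hfC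
  rw [hcomp] at hins
  constructor
  · have := Set.ncard_le_ncard (s := insert 1 {n ∈ csSet G | IsCompositeNat n}) (t := csSet G)
      (Set.insert_subset h1 (fun _ h => h.1)) hfin
    omega
  · have hP : {n ∈ csSet G | n.Prime}.ncard ≤ 3 := by
      by_contra hcon
      obtain ⟨a, b, c, d, ha, hb, hc, hd, hab, hbc, hcd⟩ :=
        four_sorted {n ∈ csSet G | n.Prime} (by omega)
      exact key4 ha.2 hb.2 hc.2 hd.2 hab hbc hcd ha.1 hb.1 hc.1 hd.1 hfC hcomp
    have hsub : csSet G ⊆ insert 1 {n ∈ csSet G | IsCompositeNat n} ∪ {n ∈ csSet G | n.Prime} := by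
      intro n hn
      by_cases hp : n.Prime
      · exact Or.inr ⟨hn, hp⟩
      · left
        by_cases hn1 : n = 1
        · exact Or.inl hn1
        · right
          refine ⟨hn, ?_, hp⟩
          have : n ≠ 0 := by
            obtain ⟨g, rfl⟩ := hn
            exact Subgroup.index_ne_zero_of_finite
          omega
    have ha := Set.ncard_le_ncard hsub
      ((hfC.insert 1).union (hfin.subset (fun _ h => h.1)))
    have hb := Set.ncard_union_le (insert 1 {n ∈ csSet G | IsCompositeNat n})
      {n ∈ csSet G | n.Prime}
    omega
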